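/- For every integer n ≥ 8, the multiplicative inverse function f_inv on F_{2^n} is not 5th order sum-free; that is, there exists a 5-dimensional F_2-affine subspace A of F_{2^n} with ∑_{x∈A} f_inv(x) = 0. -/

import Mathlib

section InverseSums

variable {F : Type*} [Field F] [Algebra (ZMod 2) F]

open Classical in
/-- The sum of the inverses of the elements of a subspace. -/
noncomputable def invSum [Fintype F] (E : Submodule (ZMod 2) F) : F := ∑ x with x ∈ E, x⁻¹

theorem invSum_eq_finsum [Fintype F] (E : Submodule (ZMod 2) F) :
    invSum E = ∑ᶠ x : E, (x : F)⁻¹ := by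
  classical
  rw [finsum_eq_sum_of_fintype, invSum]
  exact Finset.sum_subtype _ (by simp) _

theorem invSum_span_nil [Fintype F] : invSum (Submodule.span (ZMod 2) {x : F | x ∈ ([] : List F)}) = 0 := by
  classical
  refine Finset.sum_eq_zero fun x hx => ?_
  simpa using hx

theorem card_span_nil :
    Nat.card (Submodule.span (ZMod 2) {x : F | x ∈ ([] : List F)}) = 1 := by
  simp

theorem finrank_eq_of_card_eq_two_pow [Fintype F] {E : Submodule (ZMod 2) F} {k : ℕ}
    (h : Nat.card E = 2 ^ k) : Module.finrank (ZMod 2) E = k := by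
  rw [Module.natCard_eq_pow_finrank (K := ZMod 2), Nat.card_zmod] at h
  exact Nat.pow_right_injective le_rfl h

variable [CharP F 2]

/-- The additive map `x ↦ x ^ 2 + u * x`, whose kernel is `{0, u}`. -/
def artinSchreier (u : F) : F →ₗ[ZMod 2] F :=
  AddMonoidHom.toZModLinearMap 2
    { toFun := fun x => x ^ 2 + u * x
      map_zero' := by simp
      map_add' := fun x y => by rw [CharTwo.add_sq]; ring }

@[simp]
theorem artinSchreier_apply (u x : F) : artinSchreier u x = x ^ 2 + u * x := rfl

theorem artinSchreier_eq_iff {u x y : F} :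
    artinSchreier u x = artinSchreier u y ↔ x = y ∨ x = y + u := by
  have h2 : (2 : F) = 0 := CharTwo.two_eq_zero
  rw [artinSchreier_apply, artinSchreier_apply]
  have : x ^ 2 + u * x - (y ^ 2 + u * y) = (x - y) * (x - (y + u)) := by
    linear_combination (u * x - u * y - y ^ 2 + x * y) * h2
  rw [← sub_eq_zero, this, mul_eq_zero, sub_eq_zero, sub_eq_zero]

/-- Lifting a spanning list along `artinSchreier u`. -/
theorem span_cons_eq_comap_artinSchreier {u : F} (l : List F) :
    Submodule.span (ZMod 2) {x | x ∈ u :: l} =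
      (Submodule.span (ZMod 2) {x | x ∈ l.map (artinSchreier u)}).comap (artinSchreier u) := by
  have hmap : Submodule.span (ZMod 2) {x | x ∈ l.map (artinSchreier u)} =
      (Submodule.span (ZMod 2) {x | x ∈ l}).map (artinSchreier u) := by
    rw [Submodule.map_span]
    congr 1
    ext x
    simp
  have hins : {x | x ∈ u :: l} = insert u {x | x ∈ l} := by
    ext x
    simp
  have h2 : (2 : F) = 0 := CharTwo.two_eq_zero
  rw [hmap, hins, Submodule.comap_map_eq, Submodule.span_insert, sup_comm]
  congr 1
  ext x
  rw [LinearMap.mem_ker, ← map_zero (artinSchreier u), artinSchreier_eq_iff, zero_add,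
    Submodule.mem_span_singleton]
  constructor
  · rintro ⟨c, rfl⟩
    fin_cases c
    · left; exact zero_smul _ _
    · right; exact one_smul _ _
  · rintro (rfl | rfl)
    · exact ⟨0, zero_smul _ _⟩
    · exact ⟨1, one_smul _ _⟩

variable [Fintype F]

open Classical in
theorem filter_comap_artinSchreier {u y : F} {P : Submodule (ZMod 2) F}
    (hy : artinSchreier u y ∈ P) :
    (Finset.univ.filter (· ∈ P.comap (artinSchreier u))).filter
      (fun x => artinSchreier u x = artinSchreier u y) = {y, y + u} := by
  ext x
  simp only [Finset.mem_filter, Finset.mem_univ, true_and, Finset.mem_insert,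
    Finset.mem_singleton, artinSchreier_eq_iff, and_iff_right_iff_imp, Submodule.mem_comap]
  intro hx
  rwa [artinSchreier_eq_iff.2 hx]

theorem card_comap_artinSchreier {u : F} (hu : u ≠ 0) {P : Submodule (ZMod 2) F}
    (hP : P ≤ LinearMap.range (artinSchreier u)) :
    Nat.card (P.comap (artinSchreier u)) = 2 * Nat.card P := by
  classical
  rw [Nat.card_eq_fintype_card, Nat.card_eq_fintype_card, Fintype.card_subtype,
    Fintype.card_subtype, Finset.card_eq_sum_card_fiberwise (f := artinSchreier u)
    (t := Finset.univ.filter (· ∈ P)) (fun x hx => by simpa using hx),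
    Finset.sum_const_nat (m := 2), mul_comm]
  intro p hp
  simp only [Finset.mem_filter, Finset.mem_univ, true_and] at hp
  obtain ⟨y, rfl⟩ := hP hp
  rw [filter_comap_artinSchreier hp, Finset.card_pair (by simpa using hu)]

theorem invSum_comap_artinSchreier {u : F} (hu : u ≠ 0) {P : Submodule (ZMod 2) F}
    (hP : P ≤ LinearMap.range (artinSchreier u)) :
    invSum (P.comap (artinSchreier u)) = u⁻¹ + u * invSum P := by
  classical
  have h2 : (2 : F) = 0 := CharTwo.two_eq_zero
  rw [invSum, ← Finset.sum_fiberwise_of_maps_to (g := artinSchreier u)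
    (t := Finset.univ.filter (· ∈ P)) (by simp)]
  have key : ∀ p ∈ Finset.univ.filter (· ∈ P),
      ∑ x ∈ (Finset.univ.filter (· ∈ P.comap (artinSchreier u))).filter
        (fun x => artinSchreier u x = p), x⁻¹ = u * p⁻¹ + if p = 0 then u⁻¹ else 0 := by
    intro p hp
    simp only [Finset.mem_filter, Finset.mem_univ, true_and] at hp
    obtain ⟨y, rfl⟩ := hP hp
    rw [filter_comap_artinSchreier hp, Finset.sum_pair (by simpa using hu)]
    have hfac : artinSchreier u y = y * (y + u) := by rw [artinSchreier_apply]; ring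
    rw [hfac]
    by_cases h0 : y = 0
    · simp [h0]
    by_cases h1 : y + u = 0
    · have : y = u := by linear_combination h1 - u * h2
      rw [h1, this]
      simp
    · rw [if_neg (mul_ne_zero h0 h1)]
      field_simp
      linear_combination y * h2
  rw [Finset.sum_congr rfl key, Finset.sum_add_distrib, ← Finset.mul_sum, Finset.sum_ite_eq']
  simp [invSum, add_comm]

theorem card_span_cons {u : F} (hu : u ≠ 0) (l : List F) :
    Nat.card (Submodule.span (ZMod 2) {x | x ∈ u :: l}) =
      2 * Nat.card (Submodule.span (ZMod 2) {x | x ∈ l.map (artinSchreier u)}) := by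
  rw [span_cons_eq_comap_artinSchreier, card_comap_artinSchreier hu]
  rw [Submodule.span_le]
  intro x hx
  obtain ⟨y, -, rfl⟩ := List.mem_map.1 hx
  exact LinearMap.mem_range_self _ y

theorem invSum_span_cons {u : F} (hu : u ≠ 0) (l : List F) :
    invSum (Submodule.span (ZMod 2) {x | x ∈ u :: l}) =
      u⁻¹ + u * invSum (Submodule.span (ZMod 2) {x | x ∈ l.map (artinSchreier u)}) := by
  rw [span_cons_eq_comap_artinSchreier, invSum_comap_artinSchreier hu]
  rw [Submodule.span_le]
  intro x hx
  obtain ⟨y, -, rfl⟩ := List.mem_map.1 hx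
  exact LinearMap.mem_range_self _ y

end InverseSums

section BitPolynomials

/-- The binary digits of `a`, read as coefficients of a polynomial evaluated at `r`. -/
def bitEval {R : Type*} [CommRing R] (r : R) (a : ℕ) : R :=
  if a = 0 then 0 else ((a % 2 : ℕ) : R) + r * bitEval r (a / 2)
termination_by a
decreasing_by omega

/-- One reduction step modulo the polynomial `f` of degree `d`. -/
def bitReduce (f d a : ℕ) : ℕ := if a.testBit d then a ^^^ f else a

/-- Accumulating product of `a` and `b` modulo the polynomial `f` of degree `d`. -/
def bitMulAux (f d : ℕ) : ℕ → ℕ → ℕ → ℕ → ℕ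
  | 0, _, _, c => c
  | k + 1, a, b, c =>
    bitMulAux f d k (bitReduce f d (2 * a)) (b / 2) (if b % 2 = 1 then c ^^^ a else c)

/-- Product of `a` and `b` modulo the polynomial `f` of degree `d`, for `b < 2 ^ d`. -/
def bitMul (f d a b : ℕ) : ℕ := bitMulAux f d d a b 0

/-- The class of `X ^ 2 ^ k` modulo the polynomial `f` of degree `d`. -/
def bitFrobenius (f d : ℕ) : ℕ → ℕ
  | 0 => 2
  | k + 1 => bitMul f d (bitFrobenius f d k) (bitFrobenius f d k)

/-- If `is` lists the inverses of the successive leading elements of `xs` under the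
Artin-Schreier recursion, the sum of the inverses over the span of `xs`. -/
def bitInvSum (f d : ℕ) : List ℕ → List ℕ → Option ℕ
  | [], [] => some 0
  | i :: is, x :: xs =>
    if bitMul f d i x = 1 ∧ x < 2 ^ d ∧ ∀ y ∈ xs, y < 2 ^ d then
      (bitInvSum f d is (xs.map fun y => bitMul f d (y ^^^ x) y)).map
        fun s => i ^^^ bitMul f d s x
    else none
  | _, _ => none

variable {R : Type*} [CommRing R] (r : R)

theorem bitEval_zero : bitEval r 0 = 0 := by
  rw [bitEval, if_pos rfl]

theorem bitEval_eq (a : ℕ) : bitEval r a = ((a % 2 : ℕ) : R) + r * bitEval r (a / 2) := by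
  by_cases h : a = 0
  · simp [h, bitEval_zero]
  · rw [bitEval, if_neg h]

theorem bitEval_one : bitEval r 1 = 1 := by
  simp [bitEval_eq r 1, bitEval_zero]

theorem bitEval_two_mul (a : ℕ) : bitEval r (2 * a) = r * bitEval r a := by
  simp [bitEval_eq r (2 * a)]

theorem bitEval_two : bitEval r 2 = r := by
  simpa [bitEval_one] using bitEval_two_mul r 1

theorem map_bitEval {S : Type*} [CommRing S] (φ : R →+* S) (a : ℕ) :
    φ (bitEval r a) = bitEval (φ r) a := by
  induction a using Nat.strong_induction_on with
  | _ a ih =>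
    by_cases h : a = 0
    · simp [h, bitEval_zero]
    · rw [bitEval_eq r, bitEval_eq (φ r), map_add, map_mul, map_natCast, ih _ (by omega)]

variable [CharP R 2]

theorem bitEval_xor (a b : ℕ) : bitEval r (a ^^^ b) = bitEval r a + bitEval r b := by
  induction a using Nat.strong_induction_on generalizing b with
  | _ a ih =>
    by_cases h : a = 0
    · simp [h, bitEval_zero]
    · have h2 : (2 : R) = 0 := CharTwo.two_eq_zero
      rw [bitEval_eq r (a ^^^ b), bitEval_eq r a, bitEval_eq r b, Nat.xor_div_two,
        ih _ (by omega), Nat.xor_mod_two_eq, CharP.cast_eq_mod R 2 ((a + b) % 2)]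
      have : ((((a + b) % 2 % 2 : ℕ)) : R) = ((a % 2 : ℕ) : R) + ((b % 2 : ℕ) : R) := by
        rw [Nat.mod_mod, ← CharP.cast_eq_mod, ← CharP.cast_eq_mod, ← CharP.cast_eq_mod,
          Nat.cast_add]
      rw [this]
      ring

variable {r} {f d : ℕ}

theorem bitEval_bitReduce (hf : bitEval r f = 0) (a : ℕ) :
    bitEval r (bitReduce f d a) = bitEval r a := by
  rw [bitReduce]
  split_ifs
  · rw [bitEval_xor, hf, add_zero]
  · rfl

theorem bitEval_bitMulAux (hf : bitEval r f = 0) {k b : ℕ} (hb : b < 2 ^ k) (a c : ℕ) :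
    bitEval r (bitMulAux f d k a b c) = bitEval r c + bitEval r a * bitEval r b := by
  induction k generalizing a b c with
  | zero =>
    obtain rfl : b = 0 := by simpa using hb
    simp [bitMulAux, bitEval_zero]
  | succ k ih =>
    rw [bitMulAux, ih (by rw [pow_succ] at hb; omega), bitEval_bitReduce hf, bitEval_two_mul,
      bitEval_eq r b]
    rcases Nat.mod_two_eq_zero_or_one b with h | h
    · simp [h]; ring
    · simp [h, bitEval_xor]; ring

theorem bitEval_bitMul (hf : bitEval r f = 0) {a b : ℕ} (hb : b < 2 ^ d) :
    bitEval r (bitMul f d a b) = bitEval r a * bitEval r b := by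
  rw [bitMul, bitEval_bitMulAux hf hb, bitEval_zero, zero_add]

theorem bitEval_bitFrobenius (hf : bitEval r f = 0) {n : ℕ}
    (h : ∀ k < n, bitFrobenius f d k < 2 ^ d) :
    bitEval r (bitFrobenius f d n) = r ^ 2 ^ n := by
  induction n with
  | zero => simp [bitFrobenius, bitEval_two]
  | succ n ih =>
    rw [bitFrobenius, bitEval_bitMul hf (h n n.lt_succ_self),
      ih fun k hk => h k (hk.trans n.lt_succ_self), pow_succ, pow_mul, pow_two]

end BitPolynomials

section Certificates

variable {F : Type*} [Field F]

theorem bitEval_X_ne_zero {a : ℕ} (ha : a ≠ 0) :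
    bitEval (Polynomial.X : Polynomial F) a ≠ 0 := by
  induction a using Nat.strong_induction_on with
  | _ a ih =>
    rw [bitEval_eq]
    rcases Nat.mod_two_eq_zero_or_one a with h | h
    · simpa [h] using ih (a / 2) (by omega) (by omega)
    · intro h0
      have := congrArg (Polynomial.eval 0) h0
      simp [h] at this

theorem bitEval_X_not_isUnit {a : ℕ} (ha : 2 ≤ a) :
    ¬ IsUnit (bitEval (Polynomial.X : Polynomial F) a) := by
  intro h
  have h0 := Polynomial.natDegree_eq_zero_of_isUnit h
  rw [bitEval_eq, ← Polynomial.C_eq_natCast, Polynomial.natDegree_C_add,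
    Polynomial.natDegree_X_mul (bitEval_X_ne_zero (by omega))] at h0
  omega

variable [Fintype F] [CharP F 2]

theorem exists_bitEval_eq_zero {f d n : ℕ} (hcard : Fintype.card F = 2 ^ n) (hf2 : 2 ≤ f)
    (hlt : ∀ k < n, bitFrobenius f d k < 2 ^ d) (hn : bitFrobenius f d n = 2) :
    ∃ r : F, bitEval r f = 0 := by
  classical
  set p := bitEval (Polynomial.X : Polynomial F) f with hp
  have hdvd : p ∣ Polynomial.X ^ 2 ^ n - Polynomial.X := by
    rw [← AdjoinRoot.mk_eq_zero]
    have hroot : bitEval (AdjoinRoot.root p) f = 0 := by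
      rw [← AdjoinRoot.mk_X, ← map_bitEval, ← hp, AdjoinRoot.mk_self]
    have hnontriv : Nontrivial (AdjoinRoot p) := by
      rw [AdjoinRoot, Ideal.Quotient.nontrivial_iff, Ne, Ideal.span_singleton_eq_top]
      exact bitEval_X_not_isUnit hf2
    have : CharP (AdjoinRoot p) 2 := charP_of_injective_algebraMap
      (algebraMap F (AdjoinRoot p)).injective 2
    have h := bitEval_bitFrobenius (d := d) hroot hlt
    rw [hn, bitEval_two] at h
    rw [map_sub, map_pow, AdjoinRoot.mk_X, ← h, sub_self]
  have hsplit : p.Splits := by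
    refine Polynomial.Splits.of_dvd ?_ ?_ hdvd
    · rw [← hcard, ← Nat.card_eq_fintype_card]
      exact Polynomial.splits_X_pow_nat_card_sub_X
    · rw [← hcard]
      exact FiniteField.X_pow_card_sub_X_ne_zero F Fintype.one_lt_card
  have hdeg : p.degree ≠ 0 := fun h =>
    bitEval_X_not_isUnit hf2 (Polynomial.isUnit_iff_degree_eq_zero.2 h)
  obtain ⟨r, hr⟩ := hsplit.exists_eval_eq_zero hdeg
  refine ⟨r, ?_⟩
  have := map_bitEval Polynomial.X (Polynomial.evalRingHom r) f
  rw [Polynomial.coe_evalRingHom, Polynomial.eval_X] at this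
  rw [← this, ← hp, hr]

variable [Algebra (ZMod 2) F]

theorem bitInvSum_spec {f d : ℕ} {r : F} (hf : bitEval r f = 0) {is xs : List ℕ} {s : ℕ}
    (h : bitInvSum f d is xs = some s) :
    Nat.card (Submodule.span (ZMod 2) {x | x ∈ xs.map (bitEval r)}) = 2 ^ xs.length ∧
      invSum (Submodule.span (ZMod 2) {x | x ∈ xs.map (bitEval r)}) = bitEval r s := by
  induction is generalizing xs s with
  | nil =>
    cases xs with
    | nil =>
      obtain rfl : 0 = s := by simpa [bitInvSum] using h
      rw [List.map_nil, card_span_nil, invSum_span_nil, bitEval_zero]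
      simp
    | cons x xs => simp [bitInvSum] at h
  | cons i is ih =>
    cases xs with
    | nil => simp [bitInvSum] at h
    | cons x xs =>
      rw [bitInvSum] at h
      split_ifs at h with hc
      obtain ⟨hix, hx, hxs⟩ := hc
      obtain ⟨t, ht, rfl⟩ := Option.map_eq_some_iff.1 h
      obtain ⟨hcard, hsum⟩ := ih ht
      have hinv : bitEval r i * bitEval r x = 1 := by
        rw [← bitEval_bitMul hf hx, hix, bitEval_one]
      have hmap : (xs.map fun y => bitMul f d (y ^^^ x) y).map (bitEval r) =
          (xs.map (bitEval r)).map (artinSchreier (bitEval r x)) := by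
        rw [List.map_map, List.map_map]
        refine List.map_congr_left fun y hy => ?_
        simp only [Function.comp_apply, artinSchreier_apply]
        rw [bitEval_bitMul hf (hxs y hy), bitEval_xor]
        ring
      have hx0 : bitEval r x ≠ 0 := right_ne_zero_of_mul_eq_one hinv
      rw [hmap] at hcard hsum
      rw [List.map_cons, card_span_cons hx0, invSum_span_cons hx0, hcard, hsum, bitEval_xor,
        bitEval_bitMul hf hx, eq_inv_of_mul_eq_one_left hinv, List.length_map,
        List.length_cons, pow_succ]
      exact ⟨mul_comm _ _, by ring⟩

theorem exists_invSum_eq_zero_of_certificate {n : ℕ} (hcard : Fintype.card F = 2 ^ n)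
    (f d : ℕ) (is xs : List ℕ)
    (h : 2 ≤ f ∧ (∀ k < n, bitFrobenius f d k < 2 ^ d) ∧ bitFrobenius f d n = 2 ∧
      xs.length = 5 ∧ bitInvSum f d is xs = some 0) :
    ∃ E : Submodule (ZMod 2) F, Module.finrank (ZMod 2) E = 5 ∧ invSum E = 0 := by
  obtain ⟨hf2, hlt, hn, hlen, hs⟩ := h
  obtain ⟨r, hr⟩ := exists_bitEval_eq_zero hcard hf2 hlt hn
  obtain ⟨hE, hsum⟩ := bitInvSum_spec hr hs
  exact ⟨_, finrank_eq_of_card_eq_two_pow (hE.trans (by rw [hlen])), hsum.trans (bitEval_zero r)⟩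

theorem exists_invSum_eq_zero_of_lt {n : ℕ} (hcard : Fintype.card F = 2 ^ n) (hn : 8 ≤ n)
    (hn' : n < 25) :
    ∃ E : Submodule (ZMod 2) F, Module.finrank (ZMod 2) E = 5 ∧ invSum E = 0 := by
  have key := exists_invSum_eq_zero_of_certificate hcard
  interval_cases n
  · exact key 283 8 [1, 79, 11, 39, 254]
      [1, 58, 197, 114, 8] (by decide +kernel)
  · exact key 515 9 [1, 351, 38, 3, 307]
      [1, 46, 226, 341, 12] (by decide +kernel)
  · exact key 37 5 [1, 14, 25, 11, 9]
      [1, 2, 4, 8, 16] (by decide +kernel)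
  · exact key 2053 11 [1, 1847, 488, 4, 816]
      [1, 612, 1525, 326, 138] (by decide +kernel)
  · exact key 4105 12 [1, 2936, 2451, 1159, 3821]
      [1, 3572, 1649, 3687, 232] (by decide +kernel)
  · exact key 8219 13 [1, 5589, 2177, 4607, 965]
      [1, 2197, 6220, 2723, 1058] (by decide +kernel)
  · exact key 16417 14 [1, 8559, 9379, 1641, 636]
      [1, 16057, 14603, 8897, 986] (by decide +kernel)
  · exact key 37 5 [1, 14, 25, 11, 9]
      [1, 2, 4, 8, 16] (by decide +kernel)
  · exact key 283 8 [1, 79, 11, 39, 254]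
      [1, 58, 197, 114, 8] (by decide +kernel)
  · exact key 131081 17 [1, 46288, 97819, 40410, 14940]
      [1, 75890, 105851, 78116, 2540] (by decide +kernel)
  · exact key 515 9 [1, 351, 38, 3, 307]
      [1, 46, 226, 341, 12] (by decide +kernel)
  · exact key 524327 19 [1, 422851, 261195, 300381, 156865]
      [1, 288992, 454851, 37182, 75990] (by decide +kernel)
  · exact key 37 5 [1, 14, 25, 11, 9]
      [1, 2, 4, 8, 16] (by decide +kernel)
  · exact key 2097157 21 [1, 841886, 6992, 862056, 459759]
      [1, 1661953, 1851807, 427494, 607744] (by decide +kernel)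
  · exact key 2053 11 [1, 1847, 488, 4, 816]
      [1, 612, 1525, 326, 138] (by decide +kernel)
  · exact key 8388641 23 [1, 1317660, 123342, 3437111, 7398919]
      [1, 1382429, 4565274, 6122814, 2606936] (by decide +kernel)
  · exact key 283 8 [1, 79, 11, 39, 254]
      [1, 58, 197, 114, 8] (by decide +kernel)

end Certificates

section NormForm

variable {F : Type*} [Field F]

/-- The binary quadratic form `x ^ 2 + x * y + y ^ 2`. -/
def eisensteinForm (g : F × F) : F := g.1 ^ 2 + g.1 * g.2 + g.2 ^ 2

/-- Multiplication of the pairs `x + ω * y`, where `ω ^ 2 = ω + 1`. -/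
def eisensteinMul (g h : F × F) : F × F :=
  (g.1 * h.1 + g.2 * h.2, g.2 * h.1 + (g.1 + g.2) * h.2)

open Classical in
/-- The points of the conic `x ^ 2 + x * y + y ^ 2 = 1`. -/
noncomputable def conic (F : Type*) [Field F] [Fintype F] : Finset (F × F) :=
  Finset.univ.filter fun g => eisensteinForm g = 1

@[simp]
theorem mem_conic [Fintype F] {g : F × F} : g ∈ conic F ↔ eisensteinForm g = 1 := by
  simp [conic]

variable [CharP F 2]

theorem eisensteinForm_mul (g h : F × F) :
    eisensteinForm (eisensteinMul g h) = eisensteinForm g * eisensteinForm h := by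
  have h2 : (2 : F) = 0 := CharTwo.two_eq_zero
  obtain ⟨a, b⟩ := g
  obtain ⟨x, y⟩ := h
  simp only [eisensteinForm, eisensteinMul]
  grind

theorem eq_zero_of_eisensteinMul_eq_zero {g h : F × F} (h0 : eisensteinMul g h = 0)
    (hh : h ≠ 0) : eisensteinForm g = 0 := by
  have h2 : (2 : F) = 0 := CharTwo.two_eq_zero
  obtain ⟨a, b⟩ := g
  obtain ⟨x, y⟩ := h
  simp only [eisensteinForm, eisensteinMul, Prod.mk_eq_zero, ne_eq, not_and_or] at *
  rcases hh with hh | hh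
  · refine (mul_eq_zero.1 (?_ : x * _ = 0)).resolve_left hh
    grind
  · refine (mul_eq_zero.1 (?_ : y * _ = 0)).resolve_left hh
    grind

/-- Two distinct points of the conic `eisensteinForm = 1` do not differ by an isotropic vector. -/
theorem eq_of_eisensteinForm_add_eq_zero {g h : F × F} (hg : eisensteinForm g = 1)
    (hh : eisensteinForm h = 1) (h0 : eisensteinForm (g + h) = 0) : g = h := by
  have h2 : (2 : F) = 0 := CharTwo.two_eq_zero
  obtain ⟨x, y⟩ := g
  obtain ⟨x', y'⟩ := h
  obtain ⟨u, rfl⟩ : ∃ u, x' = x + u := ⟨x' - x, by ring⟩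
  obtain ⟨v, rfl⟩ : ∃ v, y' = y + v := ⟨y' - y, by ring⟩
  simp only [eisensteinForm, Prod.mk_add_mk] at *
  have hN : u ^ 2 + u * v + v ^ 2 = 0 := by grind
  have hB : x * v + y * u = 0 := by grind
  have hu : u = 0 := by
    refine pow_eq_zero_iff (two_ne_zero) |>.1 ?_
    have : u ^ 2 * (x ^ 2 + x * y + y ^ 2) = 0 := by
      have e : y * u = x * v := by grind
      have : u ^ 2 * (x ^ 2 + x * y + y ^ 2) = u ^ 2 * x ^ 2 + u * x * (y * u) + (y * u) ^ 2 := by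
        ring
      rw [this, e]
      linear_combination x ^ 2 * hN
    rwa [hg, mul_one] at this
  have hv : v = 0 := by
    refine pow_eq_zero_iff (two_ne_zero) |>.1 ?_
    rw [hu] at hN
    simpa using hN
  rw [hu, hv, add_zero, add_zero]

/-- A sum of two distinct points of the conic determines the two points. -/
theorem eq_or_eq_of_add_eq_add {g h g' h' : F × F} (hg : eisensteinForm g = 1)
    (hh : eisensteinForm h = 1) (hg' : eisensteinForm g' = 1) (hh' : eisensteinForm h' = 1)
    (hne : g ≠ h) (hadd : g + h = g' + h') : g' = g ∨ g' = h := by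
  have h2 : (2 : F) = 0 := CharTwo.two_eq_zero
  have hN : eisensteinForm (g + h) ≠ 0 := fun h0 =>
    hne (eq_of_eisensteinForm_add_eq_zero hg hh h0)
  obtain ⟨x, y⟩ := g
  obtain ⟨x', y'⟩ := g'
  obtain ⟨z, w⟩ := h
  obtain ⟨z', w'⟩ := h'
  simp only [Prod.mk_add_mk, Prod.mk.injEq] at hadd
  obtain ⟨u, hu⟩ : ∃ u, u = x + z := ⟨_, rfl⟩
  obtain ⟨v, hv⟩ : ∃ v, v = y + w := ⟨_, rfl⟩
  obtain ⟨c, rfl⟩ : ∃ c, x' = x + c := ⟨x' - x, by ring⟩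
  obtain ⟨d, rfl⟩ : ∃ d, y' = y + d := ⟨y' - y, by ring⟩
  obtain rfl : z = x + u := by grind
  obtain rfl : w = y + v := by grind
  obtain rfl : z' = x + c + u := by grind
  obtain rfl : w' = y + d + v := by grind
  simp only [eisensteinForm, Prod.mk_add_mk, Prod.mk.injEq] at *
  have hN' : u ^ 2 + u * v + v ^ 2 ≠ 0 := by grind
  have e1 : x * v + y * u = u ^ 2 + u * v + v ^ 2 := by grind
  have e2 : x * d + y * c = c ^ 2 + c * d + d ^ 2 := by grind
  have e3 : c * v = d * u := by grind
  obtain ⟨k, hc, hd⟩ : ∃ k, c = k * u ∧ d = k * v := by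
    by_cases hu0 : u = 0
    · have hv0 : v ≠ 0 := by rintro rfl; simp [hu0] at hN'
      exact ⟨d / v, by field_simp; linear_combination e3, by field_simp⟩
    · exact ⟨c / u, by field_simp, by field_simp; linear_combination -e3⟩
  rw [hc, hd] at e2
  have e4 : k * (k - 1) * (u ^ 2 + u * v + v ^ 2) = 0 := by
    linear_combination k * e1 - e2
  rcases mul_eq_zero.1 ((mul_eq_zero.1 e4).resolve_right hN') with hk | hk
  · left; simp [hc, hd, hk]
  · right; simp [hc, hd, sub_eq_zero.1 hk]

theorem eisensteinMul_injective_right [Fintype F] {d : F × F} (hd : d ≠ 0) :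
    Set.InjOn (fun g => eisensteinMul g d) (conic F) := by
  intro g hg h hh hgh
  rw [Finset.mem_coe, mem_conic] at hg hh
  refine eq_of_eisensteinForm_add_eq_zero hg hh (eq_zero_of_eisensteinMul_eq_zero ?_ hd)
  have : eisensteinMul (g + h) d = eisensteinMul g d + eisensteinMul h d := by
    ext <;> simp only [eisensteinMul, Prod.fst_add, Prod.snd_add] <;> ring
  rw [this]
  simp only at hgh
  rw [hgh, CharTwo.add_self_eq_zero]

theorem card_le_card_conic_add_two [Fintype F] : Fintype.card F ≤ (conic F).card + 2 := by
  classical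
  have h2 : (2 : F) = 0 := CharTwo.two_eq_zero
  have hsplit := Finset.card_filter_add_card_filter_not (s := (Finset.univ : Finset F))
    (fun m => m ^ 2 + m + 1 = 0)
  have h1 : (Finset.univ.filter fun m : F => m ^ 2 + m + 1 = 0).card ≤ 2 := by
    by_cases hex : ∃ m : F, m ^ 2 + m + 1 = 0
    · obtain ⟨m, hm⟩ := hex
      refine (Finset.card_le_card (t := {m, m + 1}) fun k hk => ?_).trans Finset.card_le_two
      simp only [Finset.mem_filter, Finset.mem_univ, true_and] at hk
      have : (k - m) * (k - (m + 1)) = 0 := by grind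
      rcases mul_eq_zero.1 this with h | h <;> simp [sub_eq_zero.1 h]
    · simp only [not_exists] at hex
      simp [hex]
  have h3 : (Finset.univ.filter fun m : F => ¬ m ^ 2 + m + 1 = 0).card ≤ (conic F).card := by
    refine Finset.card_le_card_of_injOn
      (fun m => (1 + m / (m ^ 2 + m + 1), 1 / (m ^ 2 + m + 1))) (fun m hm => ?_) ?_
    · simp only [Finset.coe_filter, Finset.mem_univ, true_and, Set.mem_ofPred_eq] at hm
      simp only [Finset.mem_coe, mem_conic, eisensteinForm]
      field_simp
      grind
    · intro m hm k hk hmk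
      simp only [Finset.coe_filter, Finset.mem_univ, true_and, Set.mem_ofPred_eq] at hm hk
      simp only [Prod.mk.injEq] at hmk
      obtain ⟨ha, hb⟩ := hmk
      have : m ^ 2 + m + 1 = k ^ 2 + k + 1 := by
        rw [one_div, one_div] at hb
        exact inv_injective hb
      rw [this] at ha
      exact (div_left_inj' hk).1 (add_left_cancel ha)
  rw [Finset.card_univ] at hsplit
  omega

theorem card_filter_add_eq_le [Fintype F] [DecidableEq F] {p : (F × F) × (F × F)}
    (hp : p ∈ conic F ×ˢ conic F) :
    ((conic F ×ˢ conic F).filter fun q => p.1 + p.2 + (q.1 + q.2) = 0).card ≤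
      if p.1 = p.2 then (conic F).card else 2 := by
  rw [Finset.mem_product, mem_conic, mem_conic] at hp
  split_ifs with h
  · refine Finset.card_le_card_of_injOn Prod.fst (fun q hq => ?_) fun q hq q' hq' hqq => ?_
    · simp only [Finset.coe_filter, Set.mem_ofPred_eq, Finset.mem_product] at hq
      exact hq.1.1
    · simp only [Finset.coe_filter, Set.mem_ofPred_eq, h] at hq hq'
      rw [CharTwo.add_self_eq_zero, zero_add, CharTwo.add_eq_zero] at hq hq'
      exact Prod.ext hqq (by rw [← hq.2, ← hq'.2, hqq])
  · refine (Finset.card_le_card (t := {p, p.swap}) fun q hq => ?_).trans Finset.card_le_two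
    simp only [Finset.mem_filter, Finset.mem_product, mem_conic] at hq
    obtain ⟨⟨hq1, hq2⟩, hadd⟩ := hq
    have hadd' := CharTwo.add_eq_zero.1 hadd
    rw [Finset.mem_insert, Finset.mem_singleton]
    rcases eq_or_eq_of_add_eq_add hp.1 hp.2 hq1 hq2 h hadd' with h1 | h1
    · left
      rw [h1] at hadd'
      exact Prod.ext h1 (add_left_cancel hadd').symm
    · right
      rw [h1, add_comm p.1] at hadd'
      exact Prod.ext h1 (add_left_cancel hadd').symm

end NormForm

section TraceSign

variable {F : Type*} [Field F] [Algebra (ZMod 2) F]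

/-- The quadratic character `(-1) ^ Tr x` of the additive group of `F`. -/
noncomputable def traceSign (x : F) : ℤ := if Algebra.trace (ZMod 2) F x = 0 then 1 else -1

theorem traceSign_zero : traceSign (0 : F) = 1 := by simp [traceSign]

theorem traceSign_eq_one_iff {x : F} : traceSign x = 1 ↔ Algebra.trace (ZMod 2) F x = 0 := by
  rw [traceSign]
  split_ifs with h <;> simp [h]

theorem traceSign_add (x y : F) : traceSign (x + y) = traceSign x * traceSign y := by
  simp only [traceSign, map_add]
  generalize Algebra.trace (ZMod 2) F x = a
  generalize Algebra.trace (ZMod 2) F y = b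
  decide +revert

variable [Fintype F]

theorem traceSign_sq (x : F) : traceSign (x ^ 2) = traceSign x := by
  have h := Algebra.trace_eq_of_algEquiv (FiniteField.frobeniusAlgEquivOfAlgebraic (ZMod 2) F) x
  have h' : FiniteField.frobeniusAlgEquivOfAlgebraic (ZMod 2) F x = x ^ 2 := by
    simp [ZMod.card]
  rw [h'] at h
  rw [traceSign, traceSign, h]

theorem exists_traceSign_mul_ne_one {a : F} (ha : a ≠ 0) : ∃ x, traceSign (a * x) ≠ 1 := by
  by_contra! h
  exact ha ((traceForm_nondegenerate (ZMod 2) F).1 a fun x => traceSign_eq_one_iff.1 (h x))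

theorem sum_traceSign_mul [DecidableEq F] (a : F) :
    ∑ x, traceSign (a * x) = if a = 0 then (Fintype.card F : ℤ) else 0 := by
  split_ifs with ha
  · simp [ha, traceSign_zero]
  · obtain ⟨y, hy⟩ := exists_traceSign_mul_ne_one ha
    have h : ∑ x, traceSign (a * x) = traceSign (a * y) * ∑ x, traceSign (a * x) := by
      rw [Finset.mul_sum, ← Equiv.sum_comp (Equiv.addLeft y) fun x => traceSign (a * x)]
      refine Finset.sum_congr rfl fun x _ => ?_
      rw [Equiv.coe_addLeft, mul_add, traceSign_add]
    have h' : (traceSign (a * y) - 1) * ∑ x, traceSign (a * x) = 0 := by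
      linear_combination -h
    exact (mul_eq_zero.1 h').resolve_left (sub_ne_zero.2 hy)

open Classical in
theorem sum_traceSign_mul_submodule (P : Submodule (ZMod 2) F) (c : F) :
    ∑ a with a ∈ P, traceSign (c * a) =
      if ∀ a ∈ P, traceSign (c * a) = 1 then (Nat.card P : ℤ) else 0 := by
  split_ifs with h
  · rw [Finset.sum_congr rfl fun a ha => h a (by simpa using ha), Nat.card_eq_fintype_card,
      Fintype.card_subtype]
    simp
  · push Not at h
    obtain ⟨b, hb, hne⟩ := h
    have h : ∑ a with a ∈ P, traceSign (c * a) =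
        traceSign (c * b) * ∑ a with a ∈ P, traceSign (c * a) := by
      rw [Finset.mul_sum]
      refine (Finset.sum_equiv (Equiv.addLeft b) (fun a => ?_) fun a _ => ?_).symm
      · simpa using (P.add_mem_iff_right hb).symm
      · rw [Equiv.coe_addLeft, mul_add, traceSign_add]
    have h' : (traceSign (c * b) - 1) * ∑ a with a ∈ P, traceSign (c * a) = 0 := by
      linear_combination -h
    exact (mul_eq_zero.1 h').resolve_left (sub_ne_zero.2 hne)

variable [CharP F 2]

/-- Additive Hilbert 90 in characteristic two. -/
theorem exists_sq_add_self_eq {w : F} (hw : traceSign w = 1) : ∃ t : F, t ^ 2 + t = w := by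
  have hle : LinearMap.range (artinSchreier (1 : F)) ≤ LinearMap.ker (Algebra.trace (ZMod 2) F) := by
    rintro _ ⟨t, rfl⟩
    rw [LinearMap.mem_ker, ← traceSign_eq_one_iff, artinSchreier_apply, traceSign_add,
      traceSign_sq, one_mul, traceSign]
    split_ifs <;> rfl
  have hker : Module.finrank (ZMod 2) (LinearMap.ker (artinSchreier (1 : F))) ≤ 1 := by
    rw [finrank_le_one_iff]
    refine ⟨⟨1, by simp [CharTwo.add_self_eq_zero]⟩, fun ⟨x, hx⟩ => ?_⟩
    rw [LinearMap.mem_ker, ← map_zero (artinSchreier (1 : F)), artinSchreier_eq_iff,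
      zero_add] at hx
    rcases hx with rfl | rfl
    · exact ⟨0, by ext; simp⟩
    · exact ⟨1, by ext; simp⟩
  have htr : Module.finrank (ZMod 2) (LinearMap.range (Algebra.trace (ZMod 2) F)) = 1 := by
    rw [LinearMap.range_eq_top.2 (Algebra.trace_surjective (ZMod 2) F), finrank_top,
      Module.finrank_self]
  have h1 := LinearMap.finrank_range_add_finrank_ker (artinSchreier (1 : F))
  have h2 := LinearMap.finrank_range_add_finrank_ker (Algebra.trace (ZMod 2) F)
  have heq := Submodule.eq_of_le_of_finrank_le hle (by omega)
  have hmem : w ∈ LinearMap.ker (Algebra.trace (ZMod 2) F) :=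
    LinearMap.mem_ker.2 (traceSign_eq_one_iff.1 hw)
  rw [← heq] at hmem
  obtain ⟨t, ht⟩ := hmem
  exact ⟨t, by simpa using ht⟩

theorem mem_range_artinSchreier {u w : F} (hu : u ≠ 0) (hw : traceSign (w / u ^ 2) = 1) :
    w ∈ LinearMap.range (artinSchreier u) := by
  obtain ⟨t, ht⟩ := exists_sq_add_self_eq hw
  refine ⟨u * t, ?_⟩
  rw [artinSchreier_apply]
  field_simp at ht
  linear_combination ht

end TraceSign

section ConicSum

variable {F : Type*} [Field F] [Algebra (ZMod 2) F]

/-- The character `(-1) ^ Tr` of the dot product of two pairs. -/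
noncomputable def pairSign (d g : F × F) : ℤ := traceSign (d.1 * g.1 + d.2 * g.2)

theorem pairSign_add_right (d g h : F × F) :
    pairSign d (g + h) = pairSign d g * pairSign d h := by
  rw [pairSign, pairSign, pairSign, ← traceSign_add]
  congr 1
  simp only [Prod.fst_add, Prod.snd_add]
  ring

variable [Fintype F]

theorem sum_pairSign [DecidableEq F] (g : F × F) :
    ∑ d, pairSign d g = if g = 0 then (Fintype.card F : ℤ) ^ 2 else 0 := by
  simp only [pairSign, Fintype.sum_prod_type, traceSign_add, mul_comm _ g.1, mul_comm _ g.2]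
  simp_rw [← Finset.mul_sum, ← Finset.sum_mul, sum_traceSign_mul]
  obtain ⟨a, b⟩ := g
  by_cases ha : a = 0 <;> by_cases hb : b = 0 <;> simp [ha, hb, sq]

/-- The character sum over the conic with frequency `d`. -/
noncomputable def conicSum (d : F × F) : ℤ := ∑ g ∈ conic F, pairSign d g

theorem conicSum_zero : conicSum (0 : F × F) = (conic F).card := by
  simp [conicSum, pairSign, traceSign_zero]

theorem conicSum_pow_four (d : F × F) :
    conicSum d ^ 4 = ∑ p ∈ conic F ×ˢ conic F, ∑ q ∈ conic F ×ˢ conic F,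
      pairSign d (p.1 + p.2 + (q.1 + q.2)) := by
  have h : conicSum d ^ 2 = ∑ p ∈ conic F ×ˢ conic F, pairSign d (p.1 + p.2) := by
    rw [sq, conicSum, Finset.sum_mul_sum, Finset.sum_product]
    simp only [pairSign_add_right]
  rw [show 4 = 2 * 2 from rfl, pow_mul, h, sq, Finset.sum_mul_sum]
  simp only [pairSign_add_right]

variable [CharP F 2]

theorem sum_conicSum_pow_four_le :
    ∑ d : F × F, conicSum d ^ 4 ≤ (Fintype.card F : ℤ) ^ 2 * (3 * (conic F).card ^ 2) := by
  classical
  have h : ∑ d : F × F, conicSum d ^ 4 = (Fintype.card F : ℤ) ^ 2 *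
      ∑ p ∈ conic F ×ˢ conic F,
        (((conic F ×ˢ conic F).filter fun q => p.1 + p.2 + (q.1 + q.2) = 0).card : ℤ) := by
    simp_rw [conicSum_pow_four]
    rw [Finset.sum_comm, Finset.mul_sum]
    refine Finset.sum_congr rfl fun p _ => ?_
    rw [Finset.sum_comm]
    simp_rw [sum_pairSign]
    rw [← Finset.sum_filter, Finset.sum_const, nsmul_eq_mul, mul_comm]
  rw [h]
  refine mul_le_mul_of_nonneg_left ?_ (by positivity)
  calc ∑ p ∈ conic F ×ˢ conic F,
        (((conic F ×ˢ conic F).filter fun q => p.1 + p.2 + (q.1 + q.2) = 0).card : ℤ)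
      ≤ ∑ p ∈ conic F ×ˢ conic F, ((if p.1 = p.2 then ((conic F).card : ℤ) else 0) + 2) := by
        refine Finset.sum_le_sum fun p hp => ?_
        have := card_filter_add_eq_le hp
        split_ifs at this ⊢ <;> push_cast <;> omega
    _ = 3 * (conic F).card ^ 2 := by
        rw [Finset.sum_add_distrib, Finset.sum_product]
        simp only [Finset.sum_ite_eq, Finset.sum_ite_mem, Finset.inter_self, Finset.sum_const,
          Finset.card_product, nsmul_eq_mul]
        push_cast
        ring

theorem conicSum_eisensteinMul {g : F × F} (hg : g ∈ conic F) (d : F × F) :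
    conicSum (eisensteinMul g d) = conicSum d := by
  rw [mem_conic] at hg
  have hmaps : ∀ h ∈ conic F, eisensteinMul g h ∈ conic F := fun h hh => by
    rw [mem_conic] at hh ⊢
    rw [eisensteinForm_mul, hg, hh, one_mul]
  have hinj : Set.InjOn (eisensteinMul g) (conic F) := by
    intro h _ h' _ hhh
    by_contra hne
    have h0 : eisensteinMul g (h - h') = 0 := by
      have : eisensteinMul g (h - h') = eisensteinMul g h - eisensteinMul g h' := by
        ext <;> simp only [eisensteinMul, Prod.fst_sub, Prod.snd_sub] <;> ring
      rw [this, hhh, sub_self]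
    rw [eq_zero_of_eisensteinMul_eq_zero h0 (sub_ne_zero.2 hne)] at hg
    exact zero_ne_one hg
  refine Finset.sum_nbij (eisensteinMul g) hmaps hinj
    (Finset.surjOn_of_injOn_of_card_le _ hmaps hinj le_rfl) fun h _ => ?_
  rw [pairSign, pairSign]
  congr 1
  simp only [eisensteinMul]
  ring

theorem card_conic_mul_conicSum_pow_four_le {d : F × F} (hd : d ≠ 0) :
    (conic F).card * conicSum d ^ 4 + ((conic F).card : ℤ) ^ 4 ≤
      (Fintype.card F : ℤ) ^ 2 * (3 * (conic F).card ^ 2) := by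
  classical
  refine le_trans ?_ (sum_conicSum_pow_four_le (F := F))
  have h0 : (0 : F × F) ∉ (conic F).image fun g => eisensteinMul g d := by
    intro h
    obtain ⟨g, hg, hgd⟩ := Finset.mem_image.1 h
    rw [mem_conic, eq_zero_of_eisensteinMul_eq_zero hgd hd] at hg
    exact zero_ne_one hg
  calc (conic F).card * conicSum d ^ 4 + ((conic F).card : ℤ) ^ 4
      = ∑ e ∈ insert 0 ((conic F).image fun g => eisensteinMul g d), conicSum e ^ 4 := by
        rw [Finset.sum_insert h0, conicSum_zero,
          Finset.sum_image (eisensteinMul_injective_right hd),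
          Finset.sum_congr rfl fun g hg => by rw [conicSum_eisensteinMul hg], Finset.sum_const,
          nsmul_eq_mul, add_comm]
    _ ≤ _ := Finset.sum_le_sum_of_subset_of_nonneg (Finset.subset_univ _)
        fun e _ _ => Even.pow_nonneg (by decide) _

theorem conicSum_pow_four_le {d : F × F} (hd : d ≠ 0) :
    conicSum d ^ 4 ≤ 2 * (Fintype.card F : ℤ) ^ 3 := by
  have h := card_conic_mul_conicSum_pow_four_le hd
  have hpos : 0 < ((conic F).card : ℤ) := by
    have : ((1, 0) : F × F) ∈ conic F := by simp [eisensteinForm]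
    exact_mod_cast Finset.card_pos.2 ⟨_, this⟩
  generalize ((conic F).card : ℤ) = c at *
  have hq : 0 ≤ (Fintype.card F : ℤ) := by positivity
  generalize (Fintype.card F : ℤ) = q at *
  have h1 : c * conicSum d ^ 4 ≤ c * (3 * q ^ 2 * c - c ^ 3) := by linarith
  have h2 := le_of_mul_le_mul_left h1 hpos
  nlinarith [mul_nonneg (sq_nonneg (c - q)) (by linarith : 0 ≤ c + 2 * q)]

theorem abs_conicSum_le {d : F × F} (hd : d ≠ 0) (hF : 2 ^ 25 ≤ Fintype.card F) :
    64 * |conicSum d| ≤ Fintype.card F := by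
  have h := conicSum_pow_four_le hd
  have hq : (2 ^ 25 : ℤ) ≤ Fintype.card F := by exact_mod_cast hF
  generalize (Fintype.card F : ℤ) = q at *
  refine le_of_pow_le_pow_left₀ (n := 4) (by norm_num) (by linarith) ?_
  rw [mul_pow, Even.pow_abs (by decide)]
  nlinarith [mul_le_mul_of_nonneg_right hq (by positivity : 0 ≤ q ^ 3)]

open Classical in
/-- A subspace of order eight is orthogonal to both coordinates of more than three points of
the conic. -/
theorem three_lt_card_conic_filter {P : Submodule (ZMod 2) F} (hP : Nat.card P = 8) {s : F}
    (hs : s ≠ 0) (hF : 2 ^ 25 ≤ Fintype.card F) :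
    3 < ((conic F).filter fun g =>
      (∀ a ∈ P, traceSign (s * g.1 * a) = 1) ∧ ∀ a ∈ P, traceSign (s * g.2 * a) = 1).card := by
  set N := ((conic F).filter fun g =>
      (∀ a ∈ P, traceSign (s * g.1 * a) = 1) ∧ ∀ a ∈ P, traceSign (s * g.2 * a) = 1).card
    with hN
  set Q : Finset F := Finset.univ.filter (· ∈ P) with hQ
  have hQcard : Q.card = 8 := by
    rw [← hP, Nat.card_eq_fintype_card, Fintype.card_subtype]
  have hsum : (64 * N : ℤ) = ∑ d ∈ Q ×ˢ Q, conicSum (s * d.1, s * d.2) := by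
    have h1 : ∀ g ∈ conic F, ∑ d ∈ Q ×ˢ Q, pairSign (s * d.1, s * d.2) g =
        if (∀ a ∈ P, traceSign (s * g.1 * a) = 1) ∧ ∀ a ∈ P, traceSign (s * g.2 * a) = 1
          then 64 else 0 := by
      intro g _
      have e : ∀ a b : F, pairSign (s * a, s * b) g =
          traceSign (s * g.1 * a) * traceSign (s * g.2 * b) := fun a b => by
        rw [pairSign, ← traceSign_add]
        congr 1
        ring
      rw [Finset.sum_product]
      simp only [e]
      rw [← Finset.sum_mul_sum, sum_traceSign_mul_submodule, sum_traceSign_mul_submodule, hP]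
      split_ifs <;> simp_all
    simp only [conicSum]
    rw [Finset.sum_comm, Finset.sum_congr rfl h1, ← Finset.sum_filter, Finset.sum_const,
      nsmul_eq_mul, mul_comm]
  have h0 : ((0, 0) : F × F) ∈ Q ×ˢ Q := by simp [hQ]
  have hrest : -(63 * Fintype.card F : ℤ) ≤
      64 * ∑ d ∈ (Q ×ˢ Q).erase (0, 0), conicSum (s * d.1, s * d.2) := by
    have hcard : ((Q ×ˢ Q).erase (0, 0)).card = 63 := by
      rw [Finset.card_erase_of_mem h0, Finset.card_product, hQcard]
    have : ∑ d ∈ (Q ×ˢ Q).erase (0, 0), (-(Fintype.card F : ℤ)) ≤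
        ∑ d ∈ (Q ×ˢ Q).erase (0, 0), 64 * conicSum (s * d.1, s * d.2) := by
      refine Finset.sum_le_sum fun d hd => ?_
      have hd0 : (s * d.1, s * d.2) ≠ (0 : F × F) := by
        intro h
        simp only [Prod.mk_eq_zero, mul_eq_zero, hs, false_or] at h
        exact Finset.ne_of_mem_erase hd (Prod.ext h.1 h.2)
      have := abs_conicSum_le hd0 hF
      have := neg_abs_le (conicSum (s * d.1, s * d.2))
      linarith
    rw [Finset.sum_const, hcard, ← Finset.mul_sum] at this
    rw [nsmul_eq_mul] at this
    push_cast at this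
    linarith
  have hconic := card_le_card_conic_add_two (F := F)
  rw [← Finset.add_sum_erase _ _ h0] at hsum
  simp only [mul_zero] at hsum
  rw [← Prod.zero_eq_mk, conicSum_zero] at hsum
  rw [← Prod.zero_eq_mk] at hrest
  omega

end ConicSum

section LargeFields

theorem exists_notMem_of_card_lt {α : Type*} [Fintype α] (s : Finset α)
    (h : s.card < Fintype.card α) : ∃ x, x ∉ s := by
  by_contra! hs
  exact h.not_ge (Finset.card_le_card fun x _ => hs x)

variable {F : Type*} [Field F] [Fintype F] [CharP F 2]

theorem exists_pow_four_eq (c : F) : ∃ x : F, x ^ 4 = c := by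
  obtain ⟨a, ha⟩ := FiniteField.isSquare_of_char_two (ringChar.eq F 2) c
  obtain ⟨b, hb⟩ := FiniteField.isSquare_of_char_two (ringChar.eq F 2) a
  exact ⟨b, by rw [ha, hb]; ring⟩

variable [Algebra (ZMod 2) F]

theorem exists_card_eq_eight_invSum_ne_zero (hF : 12 < Fintype.card F) :
    ∃ P : Submodule (ZMod 2) F, Nat.card P = 8 ∧ invSum P ≠ 0 := by
  classical
  have h2 : (2 : F) = 0 := CharTwo.two_eq_zero
  obtain ⟨t, ht⟩ := exists_notMem_of_card_lt ({0, 1} : Finset F)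
    (Finset.card_le_two.trans_lt (by omega))
  obtain ⟨v, hv⟩ := exists_notMem_of_card_lt ({0, 1, t, t + 1} : Finset F)
    (Finset.card_le_four.trans_lt (by omega))
  obtain ⟨w, hw⟩ := exists_notMem_of_card_lt
    ({0, 1, t, t + 1} ∪ {v, v + 1, v + t, v + t + 1} : Finset F)
    (((Finset.card_union_le _ _).trans
      (Nat.add_le_add Finset.card_le_four Finset.card_le_four)).trans_lt (by omega))
  simp only [Finset.mem_union, Finset.mem_insert, Finset.mem_singleton, not_or] at ht hv hw
  obtain ⟨⟨hw0, hw1, hw2, hw3⟩, hw4, hw5, hw6, hw7⟩ := hw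
  obtain ⟨hv0, hv1, hv2, hv3⟩ := hv
  have ha : artinSchreier 1 t ≠ 0 := by
    rw [← map_zero (artinSchreier (1 : F)), Ne, artinSchreier_eq_iff]
    simp [ht]
  set a := artinSchreier 1 t with ha_def
  have hb : ∀ x : F, x ≠ 0 → x ≠ 1 → x ≠ t → x ≠ t + 1 →
      artinSchreier a (artinSchreier 1 x) ≠ 0 := by
    intro x hx0 hx1 hx2 hx3
    rw [← map_zero (artinSchreier a), Ne, artinSchreier_eq_iff, zero_add, ha_def,
      artinSchreier_eq_iff, ← map_zero (artinSchreier (1 : F)), artinSchreier_eq_iff]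
    simp [hx0, hx1, hx2, hx3]
  have hcard : ∀ x : F, x ≠ 0 → x ≠ 1 → x ≠ t → x ≠ t + 1 →
      Nat.card (Submodule.span (ZMod 2) {y | y ∈ [1, t, x]}) = 8 ∧
      invSum (Submodule.span (ZMod 2) {y | y ∈ [1, t, x]}) =
        1 + (a⁻¹ + a * (artinSchreier a (artinSchreier 1 x))⁻¹) := by
    intro x hx0 hx1 hx2 hx3
    have h := hb x hx0 hx1 hx2 hx3
    constructor
    · rw [card_span_cons one_ne_zero, List.map_cons, card_span_cons ha, List.map_cons,
        List.map_cons, card_span_cons h, List.map_nil, List.map_nil, List.map_nil, card_span_nil]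
    · rw [invSum_span_cons one_ne_zero, List.map_cons, invSum_span_cons ha, List.map_cons,
        List.map_cons, invSum_span_cons h, List.map_nil, List.map_nil, List.map_nil,
        invSum_span_nil, mul_zero, add_zero, inv_one, one_mul]
  obtain ⟨hv8, hvs⟩ := hcard v hv0 hv1 hv2 hv3
  obtain ⟨hw8, hws⟩ := hcard w hw0 hw1 hw2 hw3
  by_cases hS : invSum (Submodule.span (ZMod 2) {y | y ∈ [1, t, v]}) = 0
  · refine ⟨_, hw8, fun hS' => ?_⟩
    rw [hvs, ← hS', hws, add_right_inj, add_right_inj, mul_right_inj' ha, inv_inj,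
      artinSchreier_eq_iff, ha_def, ← map_add, artinSchreier_eq_iff, artinSchreier_eq_iff] at hS
    rcases hS with (h | h) | (h | h)
    · exact hw4 h.symm
    · exact hw5 (by linear_combination -h - h2)
    · exact hw6 (by linear_combination -h - t * h2)
    · exact hw7 (by linear_combination -h - (t + 1) * h2)
  · exact ⟨_, hv8, hS⟩

theorem exists_invSum_eq_zero_of_card_ge (hF : 2 ^ 25 ≤ Fintype.card F) :
    ∃ E : Submodule (ZMod 2) F, Module.finrank (ZMod 2) E = 5 ∧ invSum E = 0 := by
  classical
  have h2 : (2 : F) = 0 := CharTwo.two_eq_zero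
  obtain ⟨P, hP, hS⟩ := exists_card_eq_eight_invSum_ne_zero (F := F) (by omega)
  set s := invSum P with hs
  obtain ⟨g, hg, hgne⟩ := Finset.exists_mem_notMem_of_card_lt_card
    ((Finset.card_le_three (a := (0, 1)) (b := (1, 0)) (c := (1, 1))).trans_lt
      (three_lt_card_conic_filter hP hS hF))
  obtain ⟨c, d⟩ := g
  simp only [Finset.mem_filter, mem_conic, eisensteinForm, Finset.mem_insert,
    Finset.mem_singleton, Prod.mk.injEq, not_or] at hg hgne
  obtain ⟨hQ, hc, hd⟩ := hg
  have hc0 : c ≠ 0 := by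
    rintro rfl
    have : (d - 1) * (d - 1) = 0 := by grind
    have : d = 1 := sub_eq_zero.1 (mul_self_eq_zero.1 this)
    grind
  have hc1 : c ≠ 1 := by
    rintro rfl
    have : d * (d - 1) = 0 := by grind
    rcases mul_eq_zero.1 this with h | h <;> grind
  obtain ⟨x, hx⟩ := exists_pow_four_eq (s * c)
  obtain ⟨y, hy⟩ := exists_pow_four_eq (s * d)
  have hx0 : x ≠ 0 := by
    rintro rfl
    exact mul_ne_zero hS hc0 (by rw [← hx]; simp)
  have hxy : (x ^ 2 + x * y + y ^ 2) ^ 2 = s := by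
    refine CharTwo.sq_injective ?_
    have : (x ^ 2 + x * y + y ^ 2) ^ 4 = (x ^ 4) ^ 2 + x ^ 4 * y ^ 4 + (y ^ 4) ^ 2 := by
      rw [show 4 = 2 * 2 from rfl, pow_mul]
      simp only [CharTwo.add_sq]
      ring
    show ((x ^ 2 + x * y + y ^ 2) ^ 2) ^ 2 = s ^ 2
    rw [← pow_mul, this, hx, hy]
    linear_combination s ^ 2 * hQ
  set k := x ^ 2 + x * y + y ^ 2 with hk
  have hkx : k + x ^ 2 ≠ 0 := by
    intro h
    have h1 : x ^ 2 = k := by linear_combination h - k * h2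
    refine hc1 (mul_left_cancel₀ hS ?_)
    rw [← hx, mul_one, ← hxy, ← h1]
    ring
  set m := (x ^ 2)⁻¹ with hm
  set u := x / (k + x ^ 2) with hu
  have hm0 : m ≠ 0 := inv_ne_zero (pow_ne_zero 2 hx0)
  have hu0 : u ≠ 0 := div_ne_zero hx0 hkx
  have hPm : P ≤ LinearMap.range (artinSchreier m) := by
    intro p hp
    refine mem_range_artinSchreier hm0 ?_
    rw [show p / m ^ 2 = s * c * p by rw [← hx, hm]; field_simp]
    exact hc p hp
  have hPu : P.comap (artinSchreier m) ≤ LinearMap.range (artinSchreier u) := by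
    intro z hz
    refine mem_range_artinSchreier hu0 ?_
    have hz' := hd _ hz
    have e1 : s * d * artinSchreier m z = (y ^ 2 * z) ^ 2 + y ^ 4 / x ^ 2 * z := by
      rw [← hy, artinSchreier_apply, hm]
      field_simp
    rw [e1, traceSign_add, traceSign_sq, ← traceSign_add] at hz'
    rw [← hz']
    congr 1
    rw [hu, hk]
    field_simp
    grind
  refine ⟨(P.comap (artinSchreier m)).comap (artinSchreier u),
    finrank_eq_of_card_eq_two_pow ?_, ?_⟩
  · rw [card_comap_artinSchreier hu0 hPu, card_comap_artinSchreier hm0 hPm, hP]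
    norm_num
  · rw [invSum_comap_artinSchreier hu0 hPu, invSum_comap_artinSchreier hm0 hPm, ← hs, ← hxy,
      hm, hu]
    clear_value k
    field_simp
    grind

end LargeFields

/-- For every `n ≥ 8`, the multiplicative inverse function `f_inv(x) = x⁻¹`
(with `f_inv(0) = 0`) on `F_{2^n}` is not `5`th order sum-free: there is a
`5`-dimensional `F₂`-affine subspace `A = v + E` of `F_{2^n}` with
`∑_{x ∈ A} f_inv(x) = 0`. -/
theorem inv_not_fifth_order_sum_free_of_eight_le (n : ℕ) (hn : 8 ≤ n) :
    ∃ (E : Submodule (ZMod 2) (GaloisField 2 n)) (v : GaloisField 2 n),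
      Module.finrank (ZMod 2) E = 5 ∧
      ∑ᶠ u : E, (v + (u : GaloisField 2 n))⁻¹ = 0 := by
  have : Fintype (GaloisField 2 n) := Fintype.ofFinite _
  have hcard : Fintype.card (GaloisField 2 n) = 2 ^ n := by
    rw [← Nat.card_eq_fintype_card, GaloisField.card 2 n (by omega)]
  obtain ⟨E, hE, hsum⟩ : ∃ E : Submodule (ZMod 2) (GaloisField 2 n),
      Module.finrank (ZMod 2) E = 5 ∧ invSum E = 0 := by
    rcases lt_or_ge n 25 with h | h
    · exact exists_invSum_eq_zero_of_lt hcard hn h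
    · exact exists_invSum_eq_zero_of_card_ge
        (hcard ▸ Nat.pow_le_pow_right (by norm_num) h)
  refine ⟨E, 0, hE, ?_⟩
  simpa only [zero_add, invSum_eq_finsum] using hsum
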